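/- Standing hypotheses as in the context, and assume H^L ≠ {0} and H(H^L) = H. Then W is irreducible on H if and only if the only closed subspaces of H^L invariant under W(x) for all x ∈ (1/2)L are {0} and H^L. -/

import Mathlib

/-- The smallest closed subspace of `H` containing `K` and invariant under all `W x`. -/
def smallestInvariantSubspace {G : Type*} {H : Type*} [NormedAddCommGroup H]
    [InnerProductSpace ℂ H] (W : G → H →L[ℂ] H) (K : Set H) : Submodule ℂ H :=
  sInf {S : Submodule ℂ H |
    K ⊆ (S : Set H) ∧ IsClosed (S : Set H) ∧ ∀ (x : G), ∀ ψ ∈ S, W x ψ ∈ S}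

theorem smallestInvariantSubspace_le {G H : Type*} [NormedAddCommGroup H]
    [InnerProductSpace ℂ H] {W : G → H →L[ℂ] H} {K : Set H}
    {S : Submodule ℂ H} (hK : K ⊆ S) (hS : IsClosed (S : Set H))
    (hinv : ∀ x : G, ∀ ψ ∈ S, W x ψ ∈ S) :
    smallestInvariantSubspace W K ≤ S :=
  sInf_le ⟨hK, hS, hinv⟩

theorem mul_swap_eq_one_of_alternating {G : Type*} [AddCommGroup G] {m : G → G → Circle}
    (hm₁ : ∀ x y z : G, m (x + y) z = m x z * m y z)
    (hm₂ : ∀ x y z : G, m x (y + z) = m x y * m x z)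
    (hmalt : ∀ x : G, m x x = 1) (x y : G) : m x y * m y x = 1 := by
  have h := hmalt (x + y)
  rwa [hm₁, hm₂, hm₂, hmalt, hmalt, one_mul, mul_one] at h

theorem apply_neg_eq_one_of_alternating {G : Type*} [AddCommGroup G] {m : G → G → Circle}
    (hm₂ : ∀ x y z : G, m x (y + z) = m x y * m x z)
    (hmalt : ∀ x : G, m x x = 1) (x : G) : m x (-x) = 1 := by
  have h0 : m x 0 = 1 := by
    have h := hm₂ x 0 0
    rwa [add_zero, left_eq_mul] at h
  have h := hm₂ x x (-x)
  rwa [add_neg_cancel, h0, hmalt, one_mul, eq_comm] at h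

section Representation

variable {G : Type*} [AddCommGroup G] {m : G → G → Circle}
  {H : Type*} [NormedAddCommGroup H] [InnerProductSpace ℂ H] {W : G → H →L[ℂ] H}

theorem representation_apply_apply
    (hWmul : ∀ x y : G, (W x).comp (W y) = (m x y : ℂ) • W (x + y)) (x y : G) (ψ : H) :
    W x (W y ψ) = (m x y : ℂ) • W (x + y) ψ :=
  congrArg (fun T : H →L[ℂ] H => T ψ) (hWmul x y)

theorem inner_representation_right
    (hm₂ : ∀ x y z : G, m x (y + z) = m x y * m x z)
    (hmalt : ∀ x : G, m x x = 1)
    (hW0 : W 0 = 1)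
    (hWmul : ∀ x y : G, (W x).comp (W y) = (m x y : ℂ) • W (x + y))
    (hWunitary : ∀ (x : G) (ψ φ : H), @inner ℂ H _ (W x ψ) (W x φ) = @inner ℂ H _ ψ φ)
    (x : G) (ψ φ : H) : inner ℂ ψ (W x φ) = inner ℂ (W (-x) ψ) φ := by
  rw [← hWunitary x (W (-x) ψ) φ, representation_apply_apply hWmul,
    apply_neg_eq_one_of_alternating hm₂ hmalt, add_neg_cancel, hW0]
  simp

/-- If `x + x` pairs trivially with `a`, then `W x` preserves the vectors fixed by `W a`. -/
theorem representation_apply_fixed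
    (hm₁ : ∀ x y z : G, m (x + y) z = m x z * m y z)
    (hm₂ : ∀ x y z : G, m x (y + z) = m x y * m x z)
    (hmalt : ∀ x : G, m x x = 1)
    (hWmul : ∀ x y : G, (W x).comp (W y) = (m x y : ℂ) • W (x + y))
    {x a : G} (hxa : m (x + x) a = 1) {ψ : H} (hψ : W a ψ = ψ) :
    W a (W x ψ) = W x ψ := by
  have hswap : m a x = m x a :=
    mul_right_cancel ((mul_swap_eq_one_of_alternating hm₁ hm₂ hmalt a x).trans
      (hxa.symm.trans (hm₁ x x a)))
  rw [representation_apply_apply hWmul, hswap, add_comm, ← representation_apply_apply hWmul, hψ]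

/-- If `x + x` pairs nontrivially with `a`, then `W x` maps the vectors fixed by `W a` to vectors
orthogonal to them. -/
theorem inner_representation_apply_fixed_eq_zero
    (hm₁ : ∀ x y z : G, m (x + y) z = m x z * m y z)
    (hm₂ : ∀ x y z : G, m x (y + z) = m x y * m x z)
    (hmalt : ∀ x : G, m x x = 1)
    (hWmul : ∀ x y : G, (W x).comp (W y) = (m x y : ℂ) • W (x + y))
    (hWunitary : ∀ (x : G) (ψ φ : H), @inner ℂ H _ (W x ψ) (W x φ) = @inner ℂ H _ ψ φ)
    {x a : G} (hxa : m (x + x) a ≠ 1) {ψ φ : H} (hψ : W a ψ = ψ) (hφ : W a φ = φ) :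
    inner ℂ (W x ψ) φ = 0 := by
  have hne : m x a ≠ m a x := fun h => hxa <| by
    rw [hm₁]
    nth_rewrite 2 [h]
    exact mul_swap_eq_one_of_alternating hm₁ hm₂ hmalt x a
  have hx : W x ψ = (m x a : ℂ) • W (x + a) ψ := by
    rw [← representation_apply_apply hWmul, hψ]
  have h := hWunitary a (W x ψ) φ
  rw [representation_apply_apply hWmul, hφ, add_comm, hx, inner_smul_left, inner_smul_left] at h
  rw [hx, inner_smul_left]
  by_contra h0
  exact hne (Circle.ext (star_injective (mul_right_cancel₀ (right_ne_zero_of_mul h0) h))).symm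

theorem orthogonal_invariant
    (hm₂ : ∀ x y z : G, m x (y + z) = m x y * m x z)
    (hmalt : ∀ x : G, m x x = 1)
    (hW0 : W 0 = 1)
    (hWmul : ∀ x y : G, (W x).comp (W y) = (m x y : ℂ) • W (x + y))
    (hWunitary : ∀ (x : G) (ψ φ : H), @inner ℂ H _ (W x ψ) (W x φ) = @inner ℂ H _ ψ φ)
    {S : Submodule ℂ H} (hS : ∀ x : G, ∀ ψ ∈ S, W x ψ ∈ S) (x : G) (φ : H) (hφ : φ ∈ Sᗮ) :
    W x φ ∈ Sᗮ := fun ψ hψ => by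
  rw [inner_representation_right hm₂ hmalt hW0 hWmul hWunitary]
  exact hφ _ (hS _ _ hψ)

end Representation

/-- Standing hypotheses; assume `H^L ≠ {0}` and `H(H^L) = H`. Then `W` is
irreducible on `H` iff the only closed subspaces of `H^L` invariant under `W(x)` for all
`x ∈ (1/2)L` are `{0}` and `H^L`. -/
theorem stmt_9 {G : Type*} [AddCommGroup G]
    (m : G → G → Circle)
    (hm₁ : ∀ x y z : G, m (x + y) z = m x z * m y z)
    (hm₂ : ∀ x y z : G, m x (y + z) = m x y * m x z)
    (hmalt : ∀ x : G, m x x = 1)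
    (L : AddSubgroup G)
    (hL : (L : Set G) = {x : G | ∀ a ∈ L, m x a = 1})
    {H : Type*} [NormedAddCommGroup H] [InnerProductSpace ℂ H] [CompleteSpace H]
    (W : G → H →L[ℂ] H)
    (hW0 : W 0 = 1)
    (hWmul : ∀ x y : G, (W x).comp (W y) = (m x y : ℂ) • W (x + y))
    (hWunitary : ∀ (x : G) (ψ φ : H), @inner ℂ H _ (W x ψ) (W x φ) = @inner ℂ H _ ψ φ)
    (HL : Submodule ℂ H)
    (hHL : ∀ ψ : H, ψ ∈ HL ↔ ∀ a ∈ L, W a ψ = ψ)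
    (hvac : HL ≠ ⊥)
    (hgen : smallestInvariantSubspace W (HL : Set H) = ⊤) :
    ((∀ S : Submodule ℂ H, IsClosed (S : Set H) →
        (∀ x : G, ∀ ψ ∈ S, W x ψ ∈ S) → S = ⊥ ∨ S = ⊤) ↔
      (∀ K : Submodule ℂ H, K ≤ HL → IsClosed (K : Set H) →
        (∀ x : G, x + x ∈ L → ∀ ψ ∈ K, W x ψ ∈ K) → K = ⊥ ∨ K = HL)) := by
  have hmem : ∀ x : G, x ∈ L ↔ ∀ a ∈ L, m x a = 1 := fun x => Set.ext_iff.mp hL x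
  constructor
  · intro hirr K hKL hKc hKinv
    let T : Submodule ℂ H := Submodule.span ℂ {φ | ∃ x : G, ∃ k ∈ K, W x k = φ}
    have hTinv : ∀ x : G, ∀ ψ ∈ T, W x ψ ∈ T := by
      intro x ψ hψ
      induction hψ using Submodule.span_induction with
      | mem ψ hψ =>
        obtain ⟨y, k, hk, rfl⟩ := hψ
        rw [representation_apply_apply hWmul]
        exact T.smul_mem _ (Submodule.subset_span ⟨x + y, k, hk, rfl⟩)
      | zero => simp
      | add ψ φ _ _ hψ hφ => rw [map_add]; exact T.add_mem hψ hφ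
      | smul c ψ _ hψ => rw [map_smul]; exact T.smul_mem c hψ
    have hKT : K ≤ T := fun k hk => Submodule.subset_span ⟨0, k, hk, by simp [hW0]⟩
    rcases hirr Tᗮ T.isClosed_orthogonal
      (orthogonal_invariant hm₂ hmalt hW0 hWmul hWunitary hTinv) with h | h
    · right
      have : CompleteSpace K := hKc.completeSpace_coe
      refine le_antisymm hKL fun ψ hψ => ?_
      obtain ⟨k, hk, φ, hφ, rfl⟩ := K.exists_add_mem_mem_orthogonal ψ
      have hφL : φ ∈ HL := (HL.add_mem_iff_right (hKL hk)).mp hψ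
      have hφT : φ ∈ Tᗮ := by
        rw [Submodule.mem_orthogonal']
        intro u hu
        refine Submodule.span_induction (p := fun u _ => inner ℂ φ u = 0) ?_ ?_ ?_ ?_ hu
        · rintro _ ⟨x, k', hk', rfl⟩
          rw [inner_eq_zero_symm]
          by_cases hx : x + x ∈ L
          · exact hφ _ (hKinv x hx k' hk')
          · have hx' : ∃ a ∈ L, m (x + x) a ≠ 1 := by
              simpa using mt (hmem _).mpr hx
            obtain ⟨a, ha, hxa⟩ := hx'
            exact inner_representation_apply_fixed_eq_zero hm₁ hm₂ hmalt hWmul hWunitary hxa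
              ((hHL _).mp (hKL hk') a ha) ((hHL _).mp hφL a ha)
        · simp
        · intro u v _ _ hu hv
          rw [inner_add_right, hu, hv, add_zero]
        · intro c u _ hu
          rw [inner_smul_right, hu, mul_zero]
      rw [h, Submodule.mem_bot] at hφT
      rwa [hφT, add_zero]
    · left
      rw [Submodule.orthogonal_eq_top_iff] at h
      exact le_bot_iff.mp (h ▸ hKT)
  · intro hK S hSc hSinv
    have hHLc : IsClosed (HL : Set H) := by
      have : (HL : Set H) = ⋂ a ∈ L, {ψ | W a ψ = ψ} := by
        ext ψ
        simp [hHL]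
      rw [this]
      exact isClosed_biInter fun a _ => isClosed_eq (W a).continuous continuous_id
    have hSoinv := orthogonal_invariant hm₂ hmalt hW0 hWmul hWunitary hSinv
    rcases hK (S ⊓ HL) inf_le_right (hSc.inter hHLc) (fun x hx ψ hψ =>
        ⟨hSinv x ψ hψ.1, (hHL _).mpr fun a ha =>
          representation_apply_fixed hm₁ hm₂ hmalt hWmul ((hmem _).mp hx a ha)
            ((hHL ψ).mp hψ.2 a ha)⟩) with h | h
    · left
      have : CompleteSpace S := hSc.completeSpace_coe
      have hHLS : HL ≤ Sᗮ := by
        intro ψ hψ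
        obtain ⟨s, hs, t, ht, rfl⟩ := S.exists_add_mem_mem_orthogonal ψ
        have hsL : s ∈ HL := (hHL s).mpr fun a ha => by
          have hfix := (hHL _).mp hψ a ha
          rw [map_add] at hfix
          have hdiff : W a s - s = t - W a t := by
            rw [sub_eq_sub_iff_add_eq_add, hfix, add_comm]
          have h0 : W a s - s ∈ S ⊓ Sᗮ :=
            ⟨S.sub_mem (hSinv a s hs) hs, hdiff ▸ Sᗮ.sub_mem ht (hSoinv a t ht)⟩
          rw [S.inf_orthogonal_eq_bot, Submodule.mem_bot] at h0
          exact sub_eq_zero.mp h0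
        have hs0 : s ∈ S ⊓ HL := ⟨hs, hsL⟩
        rw [h, Submodule.mem_bot] at hs0
        rwa [hs0, zero_add]
      have htop := smallestInvariantSubspace_le hHLS S.isClosed_orthogonal hSoinv
      rwa [hgen, top_le_iff, Submodule.orthogonal_eq_top_iff] at htop
    · right
      have htop := smallestInvariantSubspace_le (SetLike.coe_subset_coe.mpr (inf_eq_right.mp h)) hSc hSinv
      rwa [hgen, top_le_iff] at htop
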